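/- Integral representation under RH: assume the Riemann Hypothesis. Then for every integer n ≥ 1, λ_n^K = 2∫₀^π sin(nθ)·N((1/2)·cot(θ/2)) dθ, where N(T) denotes the number of zeros ρ of 2ξ with 0 < Im ρ ≤ T, counted with multiplicity (a finite number for each T > 0, and N(T) := 0 for T ≤ 0). -/

import Mathlib

open scoped Nat BigOperators

/-- The completed Riemann zeta function `2ξ(s) = s(s-1)π^{-s/2}Γ(s/2)ζ(s)`,
extended by its (entire) values `1` at `s = 0, 1`. -/
noncomputable def xi2 (s : ℂ) : ℂ :=
  if s = 0 ∨ s = 1 then 1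
  else s * (s - 1) * (Real.pi : ℂ) ^ (-s / 2) * Complex.Gamma (s / 2) * riemannZeta s

/-- The coefficients `A_{nm} = 2^{m-n} (2(n+m)-1)!! / ((2m-1)(n-m)!(2m)!)`. -/
noncomputable def A (n m : ℕ) : ℝ :=
  (2 : ℝ) ^ ((m : ℤ) - (n : ℤ)) * (Nat.doubleFactorial (2 * (n + m) - 1) : ℝ) /
    ((2 * (m : ℝ) - 1) * (Nat.factorial (n - m) : ℝ) * (Nat.factorial (2 * m) : ℝ))

/-- `Φ_m = log 2ξ(2m)`, a real number (the value `2ξ(2m)` is a positive real). -/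
noncomputable def PhiVal (m : ℕ) : ℝ := (Complex.log (xi2 (2 * m))).re

/-- The closed-form variant `Λ_n` of the Keiper sequence. -/
noncomputable def Lambda (n : ℕ) : ℝ := ∑ m ∈ Finset.Icc 1 n, (-1 : ℝ) ^ m * A n m * PhiVal m

/-- `Φ(z) = log 2ξ(1/(1-z))` (principal branch), analytic near `z = 0`. -/
noncomputable def PhiKL (z : ℂ) : ℂ := Complex.log (xi2 (1 / (1 - z)))

/-- Keiper's constants `λ_n^K`: the `n`-th Taylor coefficient of `Φ` at `0`
(a real number; we take the real part). -/
noncomputable def lambdaK (n : ℕ) : ℝ := (iteratedDeriv n PhiKL 0 / (Nat.factorial n : ℂ)).re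

/-- Li's constants `λ_n^L = n·λ_n^K`. -/
noncomputable def lambdaL (n : ℕ) : ℝ := n * lambdaK n

/-- The multiplicity `m_ρ` of a zero `ρ` of `2ξ`: the analytic order of
vanishing, i.e. the least `k` such that `2ξ(z) = (z - ρ)^k g(z)` near `ρ` with
`g` analytic and nonvanishing at `ρ`. -/
noncomputable def xiOrder (ρ : ℂ) : ℕ :=
  sInf {k : ℕ | ∃ g : ℂ → ℂ, AnalyticAt ℂ g ρ ∧ g ρ ≠ 0 ∧
    ∀ᶠ z in nhds ρ, xi2 z = (z - ρ) ^ k * g z}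
/-- The zero-counting function `N(T)`: the number of zeros `ρ` of `2ξ` with
`0 < Im ρ ≤ T`, counted with multiplicity (and `N(T) = 0` for `T ≤ 0`). -/
noncomputable def Ncount (T : ℝ) : ℝ :=
  ∑' ρ : {ρ : ℂ // xi2 ρ = 0 ∧ 0 < ρ.im ∧ ρ.im ≤ T}, (xiOrder ρ : ℝ)

theorem exists_eq_one_sub_div_pow_mul {G : ℂ → ℂ} (hG : Differentiable ℂ G) {a : ℂ} (ha : a ≠ 0)
    (hfin : analyticOrderAt G a ≠ ⊤) :
    ∃ g : ℂ → ℂ, Differentiable ℂ g ∧ g a ≠ 0 ∧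
      ∀ w, G w = (1 - w / a) ^ analyticOrderNatAt G a * g w := by
  set m := analyticOrderNatAt G a with hm
  obtain ⟨g₀, hg₀, hg₀a, hev⟩ := (hG.analyticAt a).analyticOrderAt_ne_top.1 hfin
  rw [← hm] at hev
  have hne : ∀ w, w ≠ a → (1 - w / a) ≠ 0 := fun w hw h ↦
    hw ((div_eq_one_iff_eq ha).1 (sub_eq_zero.1 h).symm)
  have hpow : ∀ w : ℂ, (w - a) ^ m = (-a) ^ m * (1 - w / a) ^ m := fun w ↦ by
    rw [← mul_pow]; congr 1; field_simp; ring
  set g : ℂ → ℂ := fun w ↦ if w = a then (-a) ^ m * g₀ a else G w / (1 - w / a) ^ m with hg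
  have hga : g =ᶠ[nhds a] fun w ↦ (-a) ^ m * g₀ w := by
    filter_upwards [hev] with w hw
    by_cases h : w = a
    · simp [hg, h]
    · have := pow_ne_zero m (hne w h)
      simp only [hg, if_neg h, hw, smul_eq_mul, hpow]
      field_simp
  refine ⟨g, fun w ↦ ?_, ?_, fun w ↦ ?_⟩
  · by_cases h : w = a
    · subst h
      exact (hg₀.differentiableAt.const_mul _).congr_of_eventuallyEq hga
    · have hev' : g =ᶠ[nhds w] fun w ↦ G w / (1 - w / a) ^ m := by
        filter_upwards [isOpen_ne.mem_nhds h] with v hv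
        simp only [hg, if_neg hv]
      refine DifferentiableAt.congr_of_eventuallyEq ?_ hev'
      exact (hG w).div (by fun_prop) (pow_ne_zero m (hne w h))
  · rw [hga.eq_of_nhds]
    exact mul_ne_zero (pow_ne_zero _ (neg_ne_zero.2 ha)) hg₀a
  · by_cases h : w = a
    · subst h
      rw [hev.eq_of_nhds, hga.eq_of_nhds, hpow, smul_eq_mul]
      ring
    · have := pow_ne_zero m (hne w h)
      simp only [hg, if_neg h]
      field_simp

theorem exists_eq_prod_one_sub_div_pow_mul {G : ℂ → ℂ} (hG : Differentiable ℂ G)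
    (hfin : ∀ a, analyticOrderAt G a ≠ ⊤) (S : Finset ℂ) (hS : ∀ a ∈ S, a ≠ 0) :
    ∃ g : ℂ → ℂ, Differentiable ℂ g ∧ (∀ a ∈ S, g a ≠ 0) ∧
      ∀ w, G w = (∏ a ∈ S, (1 - w / a) ^ analyticOrderNatAt G a) * g w := by
  induction S using Finset.induction_on with
  | empty => exact ⟨G, hG, by simp, by simp⟩
  | insert b S hb ih =>
    obtain ⟨g, hg, hgS, hGg⟩ := ih fun a ha ↦ hS a (Finset.mem_insert_of_mem ha)
    have hb0 : b ≠ 0 := hS b (Finset.mem_insert_self b S)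
    set P : ℂ → ℂ := fun w ↦ ∏ a ∈ S, (1 - w / a) ^ analyticOrderNatAt G a with hP
    have hPd : Differentiable ℂ P := by fun_prop
    have hPb : P b ≠ 0 := by
      refine Finset.prod_ne_zero_iff.2 fun a ha ↦ pow_ne_zero _ fun h ↦ hb ?_
      have ha0 : a ≠ 0 := hS a (Finset.mem_insert_of_mem ha)
      rwa [(div_eq_one_iff_eq ha0).1 (sub_eq_zero.1 h).symm]
    have hord : analyticOrderAt g b = analyticOrderAt G b := by
      have : G = P * g := funext hGg
      rw [this, analyticOrderAt_mul (hPd.analyticAt b) (hg.analyticAt b),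
        (hPd.analyticAt b).analyticOrderAt_eq_zero.2 hPb, zero_add]
    obtain ⟨g₁, hg₁, hg₁b, hgg₁⟩ := exists_eq_one_sub_div_pow_mul hg hb0 (hord ▸ hfin b)
    refine ⟨g₁, hg₁, fun a ha ↦ ?_, fun w ↦ ?_⟩
    · rcases Finset.mem_insert.1 ha with rfl | ha
      · exact hg₁b
      · exact right_ne_zero_of_mul (hgg₁ a ▸ hgS a ha)
    · rw [Finset.prod_insert hb, hGg w, hgg₁ w, analyticOrderNatAt, hord, ← analyticOrderNatAt]
      ring

theorem exists_eq_mul_exp_of_ne_zero {g : ℂ → ℂ} {R : ℝ} (hR : 0 < R) (hg : Differentiable ℂ g)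
    (hne : ∀ w ∈ Metric.ball (0 : ℂ) R, g w ≠ 0) :
    ∃ L : ℂ → ℂ, L 0 = 0 ∧ DifferentiableOn ℂ L (Metric.ball 0 R) ∧
      ∀ w ∈ Metric.ball (0 : ℂ) R, g w = g 0 * Complex.exp (L w) := by
  have hd : DifferentiableOn ℂ (fun w ↦ deriv g w / g w) (Metric.ball 0 R) :=
    (hg.contDiff.differentiable_deriv_two.differentiableOn).div hg.differentiableOn hne
  obtain ⟨L, hL0, hL⟩ := hd.isExactOn_ball.with_val_at 0 0
  refine ⟨L, hL0, fun w hw ↦ (hL w hw).differentiableAt.differentiableWithinAt, ?_⟩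
  have hconst : ∀ w ∈ Metric.ball (0 : ℂ) R,
      HasDerivAt (fun w ↦ g w * Complex.exp (-L w)) 0 w := fun w hw ↦ by
    refine ((hg w).hasDerivAt.mul (hL w hw).neg.cexp).congr_deriv ?_
    have e : g w * (deriv g w / g w) = deriv g w := mul_div_cancel₀ _ (hne w hw)
    change deriv g w * Complex.exp (-L w) +
      g w * (Complex.exp (-L w) * -(deriv g w / g w)) = 0
    linear_combination -Complex.exp (-L w) * e
  intro w hw
  have h0 : (0 : ℂ) ∈ Metric.ball (0 : ℂ) R := Metric.mem_ball_self hR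
  have := (convex_ball (0 : ℂ) R).is_const_of_fderivWithin_eq_zero (𝕜 := ℂ)
    (f := fun w ↦ g w * Complex.exp (-L w))
    (fun w hw ↦ (hconst w hw).differentiableAt.differentiableWithinAt)
    (fun w hw ↦ by
      rw [fderivWithin_of_isOpen Metric.isOpen_ball hw]
      ext
      simp [(hconst w hw).deriv]) hw h0
  simp only [hL0, neg_zero, Complex.exp_zero, mul_one] at this
  rw [← this, mul_assoc, ← Complex.exp_add]
  simp

/-- Finite Hadamard factorization on a disc: the zero-free part is the exponential of a function
controlled by the growth of `G` on a four times larger circle. -/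
theorem exists_eq_prod_mul_exp {G : ℂ → ℂ} (hG : Differentiable ℂ G) (hG0 : G 0 ≠ 0)
    (hfin : ∀ a, analyticOrderAt G a ≠ ⊤) {R M : ℝ} (hR : 0 < R) (hM : 0 < M)
    (hb : ∀ w : ℂ, ‖w‖ = 4 * R → ‖G w‖ ≤ ‖G 0‖ * Real.exp M)
    (S : Finset ℂ) (hS : ∀ a, a ∈ S ↔ G a = 0 ∧ ‖a‖ ≤ R) :
    ∃ L : ℂ → ℂ, DifferentiableOn ℂ L (Metric.ball 0 R) ∧
      ∀ w ∈ Metric.ball (0 : ℂ) R, ‖L w‖ ≤ 2 * M * ‖w‖ / (R - ‖w‖) ∧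
        G w = G 0 * (∏ a ∈ S, (1 - w / a) ^ analyticOrderNatAt G a) * Complex.exp (L w) := by
  have hS0 : ∀ a ∈ S, a ≠ 0 := fun a ha h ↦ hG0 (h ▸ ((hS a).1 ha).1)
  obtain ⟨g, hg, hgS, hGg⟩ := exists_eq_prod_one_sub_div_pow_mul hG hfin S hS0
  have hg0 : g 0 = G 0 := by simp [hGg 0]
  have hgne : ∀ w ∈ Metric.ball (0 : ℂ) R, g w ≠ 0 := fun w hw h ↦ by
    have hw' : w ∈ S := (hS w).2 ⟨by rw [hGg, h, mul_zero], (mem_ball_zero_iff.1 hw).le⟩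
    exact hgS w hw' h
  obtain ⟨L, hL0, hL, hgL⟩ := exists_eq_mul_exp_of_ne_zero hR hg hgne
  have hgb : ∀ w ∈ Metric.ball (0 : ℂ) R, ‖g w‖ ≤ ‖G 0‖ * Real.exp M := fun w hw ↦ by
    have h4 : (0 : ℝ) < 4 * R := by positivity
    refine Complex.norm_le_of_forall_mem_frontier_norm_le (U := Metric.ball (0 : ℂ) (4 * R))
      Metric.isBounded_ball hg.diffContOnCl (fun z hz ↦ ?_) (subset_closure ?_)
    · rw [frontier_ball _ h4.ne', mem_sphere_zero_iff_norm] at hz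
      refine le_trans ?_ (hb z hz)
      rw [hGg z, norm_mul]
      refine le_mul_of_one_le_left (norm_nonneg _) ?_
      rw [norm_prod]
      refine Finset.prod_induction _ (1 ≤ ·) (fun _ _ ↦ one_le_mul_of_one_le_of_one_le) le_rfl
        fun a ha ↦ ?_
      rw [norm_pow]
      refine one_le_pow₀ ?_
      have haR := ((hS a).1 ha).2
      have ha0 : 0 < ‖a‖ := norm_pos_iff.2 (hS0 a ha)
      have h1 : (4 : ℝ) ≤ ‖z / a‖ := by
        rw [norm_div, hz, le_div_iff₀ ha0]
        linarith
      have h2 := norm_sub_norm_le (z / a) 1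
      rw [norm_sub_rev, norm_one] at h2
      linarith
    · rw [mem_ball_zero_iff] at hw ⊢
      linarith
  refine ⟨L, hL, fun w hw ↦ ⟨?_, ?_⟩⟩
  · refine Complex.borelCaratheodory_zero hM hL (fun z hz ↦ ?_) hR hw hL0
    have h1 := hgb z hz
    rw [hgL z hz, hg0, norm_mul, Complex.norm_exp] at h1
    exact Real.exp_le_exp.1 (le_of_mul_le_mul_left h1 (norm_pos_iff.2 hG0))
  · rw [hGg w, hgL w hw, hg0]
    ring

theorem analyticAt_log_one_sub_mul (c : ℂ) :
    AnalyticAt ℂ (fun z ↦ Complex.log (1 - c * z)) 0 :=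
  AnalyticAt.clog (by fun_prop) (by simp)

theorem iteratedDeriv_log_one_sub_mul (c : ℂ) {n : ℕ} (hn : 1 ≤ n) :
    iteratedDeriv n (fun z ↦ Complex.log (1 - c * z)) 0 / (n ! : ℂ) = -(c ^ n / n) := by
  obtain ⟨k, rfl⟩ := Nat.exists_eq_add_of_le' hn
  have h : deriv (fun z ↦ Complex.log (1 - c * z)) =ᶠ[nhds 0] fun z ↦ -c * (-c * z + 1)⁻¹ := by
    have hc : ContinuousAt (fun z : ℂ ↦ 1 - c * z) 0 := by fun_prop
    filter_upwards [hc.preimage_mem_nhds (Complex.isOpen_slitPlane.mem_nhds (by simp))] with z hz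
    have hd : HasDerivAt (fun z : ℂ ↦ 1 - c * z) (-c) z := by
      simpa using ((hasDerivAt_id z).const_mul c).const_sub 1
    rw [(hd.clog hz).deriv, div_eq_mul_inv]
    congr 2
    ring
  rw [iteratedDeriv_succ', h.iteratedDeriv_eq, iteratedDeriv_const_mul_field,
    iteratedDeriv_eq_iterate, iter_deriv_inv_linear]
  have hf : ((k ! : ℕ) : ℂ) ≠ 0 := by exact_mod_cast k.factorial_ne_zero
  have hk : ((k : ℂ) + 1) ≠ 0 := by exact_mod_cast k.succ_ne_zero
  simp only [mul_zero, zero_add, one_zpow, mul_one, Nat.factorial_succ, Nat.cast_mul, neg_pow c,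
    Nat.cast_add, Nat.cast_one]
  field_simp
  rw [← pow_mul, mul_comm k 2, pow_mul]
  simp [pow_succ']

/-- Taylor coefficients of the logarithm of a product of quadratic factors
`(1 - c z) (1 - c⁻¹ z) / (1 - z) ^ 2` and an exponential. -/
theorem iteratedDeriv_log_prod_mul_exp {ι : Type*} (S : Finset ι) (c : ι → ℂ) (m : ι → ℕ) (K : ℂ)
    {F E : ℂ → ℂ} (hE : AnalyticAt ℂ E 0) (hF0 : F 0 = 1)
    (hF : ∀ᶠ z in nhds 0, F z =
      K * (∏ a ∈ S, ((1 - c a * z) * (1 - (c a)⁻¹ * z) / (1 - z) ^ 2) ^ m a) * Complex.exp (E z))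
    {n : ℕ} (hn : 1 ≤ n) :
    iteratedDeriv n (fun z ↦ Complex.log (F z)) 0 / (n ! : ℂ) =
      ∑ a ∈ S, (m a : ℂ) * ((2 - (c a) ^ n - ((c a)⁻¹) ^ n) / n) +
        iteratedDeriv n E 0 / (n ! : ℂ) := by
  set l : ℂ → ℂ → ℂ := fun c z ↦ Complex.log (1 - c * z) with hl
  have hla : ∀ c, AnalyticAt ℂ (l c) 0 := analyticAt_log_one_sub_mul
  set Q : ι → ℂ → ℂ := fun a z ↦ (m a : ℂ) * (l (c a) z + l (c a)⁻¹ z - 2 * l 1 z) with hQ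
  have hQa : ∀ a, AnalyticAt ℂ (Q a) 0 := fun a ↦ by
    have h1 := hla (c a)
    have h2 := hla (c a)⁻¹
    have h3 := hla 1
    simp only [hQ]
    fun_prop
  set Ψ : ℂ → ℂ := fun z ↦ (∑ a ∈ S, Q a z) + E z with hΨ
  have hΨa : AnalyticAt ℂ Ψ 0 := (Finset.analyticAt_fun_sum S fun a _ ↦ hQa a).add hE
  have hexpl : ∀ c : ℂ, ∀ᶠ z in nhds 0, Complex.exp (l c z) = 1 - c * z := fun c ↦ by
    have hc : ContinuousAt (fun z : ℂ ↦ 1 - c * z) 0 := by fun_prop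
    filter_upwards [hc.eventually_ne (y := 0) (by simp)] with z hz
    exact Complex.exp_log hz
  have hexpΨ : ∀ᶠ z in nhds 0, F z = K * Complex.exp (Ψ z) := by
    filter_upwards [hF, hexpl 1, (Finset.eventually_all S).2 fun a _ ↦ hexpl (c a),
      (Finset.eventually_all S).2 fun a _ ↦ hexpl (c a)⁻¹] with z hz h1 h2 h3
    rw [hz, hΨ, Complex.exp_add, Complex.exp_sum, mul_assoc]
    congr 2
    refine Finset.prod_congr rfl fun a ha ↦ ?_
    rw [hQ, Complex.exp_nat_mul, Complex.exp_sub, Complex.exp_add, h2 a ha, h3 a ha,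
      show (2 : ℂ) * l 1 z = ((2 : ℕ) : ℂ) * l 1 z by norm_num, Complex.exp_nat_mul, h1, one_mul]
  have hK : K * Complex.exp (Ψ 0) = 1 := by rw [← hexpΨ.self_of_nhds, hF0]
  have hlog : (fun z ↦ Complex.log (F z)) =ᶠ[nhds 0] fun z ↦ -Ψ 0 + Ψ z := by
    have ht : Filter.Tendsto (fun z ↦ (-Ψ 0 + Ψ z).im) (nhds 0) (nhds 0) := by
      have := Complex.continuous_im.continuousAt.tendsto.comp
        (hΨa.continuousAt.tendsto.const_add (-Ψ 0))
      simpa [Function.comp_def] using this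
    filter_upwards [hexpΨ, ht.eventually_lt_const Real.pi_pos,
      ht.eventually_const_lt (neg_lt_zero.2 Real.pi_pos)] with z hz h1 h2
    have : F z = Complex.exp (-Ψ 0 + Ψ z) := by
      rw [hz, Complex.exp_add (-Ψ 0), Complex.exp_neg, eq_inv_of_mul_eq_one_left hK]
    rw [this, Complex.log_exp h2 h1.le]
  have hcd : ∀ {f : ℂ → ℂ}, AnalyticAt ℂ f 0 → ContDiffAt ℂ n f 0 := fun h ↦ h.contDiffAt
  have hQn : ∀ a, iteratedDeriv n (Q a) 0 / (n ! : ℂ) =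
      (m a : ℂ) * ((2 - (c a) ^ n - ((c a)⁻¹) ^ n) / n) := fun a ↦ by
    have e1 : ∀ c, iteratedDeriv n (l c) 0 / (n ! : ℂ) = -(c ^ n / n) := fun c ↦
      iteratedDeriv_log_one_sub_mul c hn
    have h3 := hcd ((hla 1).const_smul (c := (2 : ℂ)))
    simp only [hQ]
    rw [iteratedDeriv_const_mul_field,
      iteratedDeriv_fun_sub ((hcd (hla _)).add (hcd (hla _))) (by simpa using! h3),
      iteratedDeriv_fun_add (hcd (hla _)) (hcd (hla _)), iteratedDeriv_const_mul_field,
      mul_div_assoc, sub_div, add_div, mul_div_assoc, e1, e1, e1]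
    ring
  rw [hlog.iteratedDeriv_eq, iteratedDeriv_const_add hn, hΨ,
    iteratedDeriv_fun_add (ContDiffAt.sum fun a _ ↦ hcd (hQa a)) (hcd hE),
    iteratedDeriv_fun_sum fun a _ ↦ hcd (hQa a), add_div, Finset.sum_div]
  simp only [hQn]

open HurwitzZeta in
theorem hurwitzEvenFEPair_zero_f_modif_eq_norm (t : ℝ) (ht : 0 < t) :
    (hurwitzEvenFEPair 0).f_modif t = (‖(hurwitzEvenFEPair 0).f_modif t‖ : ℂ) := by
  have hone : ∀ x : ℝ, 0 < x → 1 ≤ evenKernel 0 x := fun x hx ↦ by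
    have h := hasSum_int_evenKernel₀ 0 hx
    simp only [QuotientAddGroup.mk_zero, if_true] at h
    have := h.nonneg fun n ↦ by split_ifs <;> positivity
    linarith
  suffices ∃ r : ℝ, 0 ≤ r ∧ (hurwitzEvenFEPair 0).f_modif t = r by
    obtain ⟨r, hr, h⟩ := this
    rw [h, Complex.norm_of_nonneg hr]
  rcases lt_trichotomy t 1 with h1 | rfl | h1
  · refine ⟨1 / t ^ (1 / 2 : ℝ) * (evenKernel 0 (1 / t) - 1),
      mul_nonneg (by positivity) (sub_nonneg.2 (hone _ (by positivity))), ?_⟩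
    have hf : evenKernel 0 t = 1 / t ^ (1 / 2 : ℝ) * evenKernel 0 (1 / t) := by
      rw [evenKernel_functional_equation, evenKernel_eq_cosKernel_of_zero]
    have ha : t ∈ Set.Ioo (0 : ℝ) 1 := ⟨ht, h1⟩
    have hb : t ∉ Set.Ioi (1 : ℝ) := by simp [h1.le]
    simp only [WeakFEPair.f_modif, Pi.add_apply, Set.indicator_of_mem ha,
      Set.indicator_of_notMem hb, hurwitzEvenFEPair, Function.comp_apply, hf,
      Real.rpow_neg ht.le]
    push_cast
    simp only [smul_eq_mul]
    ring
  · exact ⟨0, le_rfl, by simp [WeakFEPair.f_modif]⟩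
  · refine ⟨evenKernel 0 t - 1, sub_nonneg.2 (hone t ht), ?_⟩
    have ha : t ∉ Set.Ioo (0 : ℝ) 1 := fun h ↦ absurd h.2 h1.not_gt
    have hb : t ∈ Set.Ioi (1 : ℝ) := h1
    simp [WeakFEPair.f_modif, ha, hb, hurwitzEvenFEPair]

open MeasureTheory in
theorem norm_mellin_le_of_eq_norm {f : ℝ → ℂ} (hf : ∀ t, 0 < t → f t = (‖f t‖ : ℂ))
    (hconv : ∀ s, MellinConvergent f s) {a b : ℝ} {s : ℂ} (ha : a ≤ s.re) (hb : s.re ≤ b) :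
    ‖mellin f s‖ ≤ (mellin f a).re + (mellin f b).re := by
  have h_int : ∀ σ : ℝ, IntegrableOn (fun t : ℝ ↦ t ^ (σ - 1) * ‖f t‖) (Set.Ioi 0) := fun σ ↦ by
    refine (integrableOn_congr_fun (fun t (ht : 0 < t) ↦ ?_) measurableSet_Ioi).1 (hconv σ).norm
    rw [norm_smul, Complex.norm_cpow_eq_rpow_re_of_pos ht]
    simp
  have hreal : ∀ σ : ℝ, (mellin f σ).re = ∫ t in Set.Ioi (0 : ℝ), t ^ (σ - 1) * ‖f t‖ := fun σ ↦ by
    have : mellin f σ = ((∫ t in Set.Ioi (0 : ℝ), t ^ (σ - 1) * ‖f t‖ : ℝ) : ℂ) := by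
      rw [mellin, ← integral_complex_ofReal]
      refine setIntegral_congr_fun measurableSet_Ioi fun t (ht : 0 < t) ↦ ?_
      simp only [smul_eq_mul]
      rw [hf t ht, Complex.ofReal_mul, Complex.ofReal_cpow ht.le]
      simp
    rw [this, Complex.ofReal_re]
  rw [hreal, hreal, ← integral_add (h_int a) (h_int b)]
  refine (norm_integral_le_integral_norm _).trans ?_
  refine setIntegral_mono_on (hconv s).norm ((h_int a).add (h_int b)) measurableSet_Ioi
    fun t (ht : 0 < t) ↦ ?_
  rw [norm_smul, Complex.norm_cpow_eq_rpow_re_of_pos ht, ← add_mul, Complex.sub_re, Complex.one_re]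
  gcongr
  rcases le_total t 1 with h | h
  · refine le_add_of_le_of_nonneg ?_ (by positivity)
    exact Real.rpow_le_rpow_of_exponent_ge ht h (by linarith)
  · refine le_add_of_nonneg_of_le (by positivity) ?_
    exact Real.rpow_le_rpow_of_exponent_le h (by linarith)

theorem norm_completedRiemannZeta₀_le {a b : ℝ} {s : ℂ} (ha : a ≤ s.re) (hb : s.re ≤ b) :
    ‖completedRiemannZeta₀ s‖ ≤
      (completedRiemannZeta₀ a).re + (completedRiemannZeta₀ b).re := by
  have h := norm_mellin_le_of_eq_norm hurwitzEvenFEPair_zero_f_modif_eq_norm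
    (fun s ↦ ((HurwitzZeta.hurwitzEvenFEPair 0).isStrongFEPair_toStrongFEPair.hasMellin s).1)
    (a := a / 2) (b := b / 2) (s := s / 2) (by simp; linarith) (by simp; linarith)
  have e : ∀ s, completedRiemannZeta₀ s =
    mellin (HurwitzZeta.hurwitzEvenFEPair 0).f_modif (s / 2) / 2 := fun _ ↦ rfl
  rw [e, e, e, norm_div]
  simp only [Complex.ofReal_div, Complex.ofReal_ofNat] at h
  simp only [Complex.div_ofNat_re, Complex.norm_ofNat]
  linarith

/-- The entire function `1 + s (s - 1) Λ₀(s)`, which agrees with `xi2` off the trivial zeros. -/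
noncomputable def xiEntire (s : ℂ) : ℂ := 1 + s * (s - 1) * completedRiemannZeta₀ s

theorem differentiable_xiEntire : Differentiable ℂ xiEntire := by
  have := differentiable_completedZeta₀
  unfold xiEntire
  fun_prop

theorem xiEntire_one_sub (s : ℂ) : xiEntire (1 - s) = xiEntire s := by
  simp only [xiEntire, completedRiemannZeta₀_one_sub]
  ring

theorem xiEntire_one : xiEntire 1 = 1 := by simp [xiEntire]

theorem xiEntire_eq_mul_completedRiemannZeta {s : ℂ} (h0 : s ≠ 0) (h1 : s ≠ 1) :
    xiEntire s = s * (s - 1) * completedRiemannZeta s := by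
  have h2 : 1 - s ≠ 0 := sub_ne_zero.2 h1.symm
  rw [xiEntire, completedRiemannZeta_eq]
  field_simp
  ring

theorem xi2_eq_xiEntire {s : ℂ} (hs : 0 < s.re ∨ s.im ≠ 0) : xi2 s = xiEntire s := by
  have h0 : s ≠ 0 := by rintro rfl; simp at hs
  rw [xi2]
  split_ifs with h
  · rcases h with rfl | rfl
    · exact absurd rfl h0
    · exact xiEntire_one.symm
  · push Not at h
    have hG : s.Gammaℝ ≠ 0 := fun hG ↦ by
      obtain ⟨n, rfl⟩ := Complex.Gammaℝ_eq_zero_iff.1 hG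
      rcases hs with hs | hs
      · have : (0 : ℝ) ≤ 2 * n := by positivity
        simp at hs
        linarith
      · simp at hs
    rw [xiEntire_eq_mul_completedRiemannZeta h0 h.2, riemannZeta_def_of_ne_zero h0, mul_assoc _ _
      (Complex.Gamma _), ← Complex.Gammaℝ_def]
    field_simp

theorem re_eq_one_half_of_xiEntire_eq_zero (hRH : RiemannHypothesis) {s : ℂ}
    (hs : xiEntire s = 0) : s.re = 1 / 2 := by
  have key : ∀ s : ℂ, xiEntire s = 0 → 1 / 2 ≤ s.re → s.re = 1 / 2 := fun s hs hre ↦ by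
    have h0 : s ≠ 0 := by rintro rfl; norm_num at hre
    have h1 : s ≠ 1 := by rintro rfl; simp [xiEntire_one] at hs
    rw [xiEntire_eq_mul_completedRiemannZeta h0 h1] at hs
    have hz : completedRiemannZeta s = 0 := by simpa [h0, sub_ne_zero.2 h1] using hs
    refine hRH s (by rw [riemannZeta_def_of_ne_zero h0, hz, zero_div]) ?_ h1
    rintro ⟨n, rfl⟩
    have : (0 : ℝ) ≤ n := by positivity
    simp at hre
    linarith
  rcases le_total (1 / 2) s.re with h | h
  · exact key s hs h
  · have := key (1 - s) (by rwa [xiEntire_one_sub]) (by simp; linarith)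
    simp at this
    linarith

theorem xiEntire_one_half_ne_zero : xiEntire (1 / 2) ≠ 0 := fun h ↦ by
  have hΛ : completedRiemannZeta₀ (1 / 2) = 4 := by
    rw [xiEntire] at h
    linear_combination -4 * h
  have h2 : (completedRiemannZeta₀ 2).re = (Real.pi / 3 - 1) / 2 := by
    have hz : completedRiemannZeta 2 = (Real.pi / 6 : ℂ) := by
      have h := riemannZeta_def_of_ne_zero (s := 2) two_ne_zero
      have hp : (Real.pi : ℂ) ≠ 0 := by exact_mod_cast Real.pi_ne_zero
      rw [riemannZeta_two, Complex.Gammaℝ_def, neg_div, div_self two_ne_zero, Complex.Gamma_one,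
        Complex.cpow_neg_one] at h
      field_simp at h
      field_simp
      linear_combination -h
    have : completedRiemannZeta₀ 2 = (((Real.pi / 3 - 1) / 2 : ℝ) : ℂ) := by
      have h := completedRiemannZeta_eq 2
      rw [hz] at h
      push_cast
      linear_combination -h
    rw [this, Complex.ofReal_re]
  have h1 : completedRiemannZeta₀ (-1) = completedRiemannZeta₀ 2 := by
    rw [← completedRiemannZeta₀_one_sub]
    norm_num
  have hb := norm_completedRiemannZeta₀_le (a := -1) (b := 2) (s := 1 / 2) (by norm_num)
    (by norm_num)
  push_cast at hb
  rw [hΛ, h1, h2] at hb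
  have := Real.pi_lt_four
  norm_num at hb
  linarith

theorem exists_factorial_le_mul_exp_sq {δ : ℝ} (hδ : 0 < δ) :
    ∃ C : ℝ, 0 < C ∧ ∀ n : ℕ, (n ! : ℝ) ≤ C * Real.exp (δ * n ^ 2) := by
  set η := δ / 2 with hη
  have hη0 : 0 < η := by positivity
  refine ⟨Real.exp ((Real.log η) ^ 2 / (4 * η)), Real.exp_pos _, fun n ↦ ?_⟩
  have h1 : (n : ℝ) ≤ Real.exp (η * n - Real.log η) := by
    rw [Real.exp_sub, Real.exp_log hη0, le_div_iff₀ hη0]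
    have := Real.add_one_le_exp (η * n)
    linarith
  calc (n ! : ℝ) ≤ (n : ℝ) ^ n := by exact_mod_cast Nat.factorial_le_pow n
    _ ≤ (Real.exp (η * n - Real.log η)) ^ n := by gcongr
    _ = Real.exp (n * (η * n - Real.log η)) := by rw [Real.exp_nat_mul]
    _ ≤ Real.exp ((Real.log η) ^ 2 / (4 * η) + δ * n ^ 2) := by
      gcongr
      have h2 : (Real.log η) ^ 2 / (4 * η) + δ * n ^ 2 - n * (η * n - Real.log η) =
          (2 * η * n + Real.log η) ^ 2 / (4 * η) := by
        rw [show δ = 2 * η by rw [hη]; ring]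
        field_simp
        ring
      have : 0 ≤ (2 * η * n + Real.log η) ^ 2 / (4 * η) := by positivity
      linarith
    _ = _ := Real.exp_add _ _

theorem norm_riemannZeta_le_of_two_le_re {s : ℂ} (hs : 2 ≤ s.re) :
    ‖riemannZeta s‖ ≤ ∑' n : ℕ, 1 / ((n : ℝ) + 1) ^ 2 := by
  rw [zeta_eq_tsum_one_div_nat_add_one_cpow (by linarith)]
  have hsum : Summable fun n : ℕ ↦ 1 / ((n : ℝ) + 1) ^ 2 := by
    exact_mod_cast (summable_nat_add_iff 1).2 (Real.summable_one_div_nat_pow.2 one_lt_two)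
  refine tsum_of_norm_bounded hsum.hasSum fun n ↦ ?_
  have h1 : (0 : ℝ) < (n : ℝ) + 1 := by positivity
  rw [norm_div, norm_one, show ((n : ℂ) + 1) = (((n : ℝ) + 1 : ℝ) : ℂ) by push_cast; rfl,
    Complex.norm_cpow_eq_rpow_re_of_pos h1, ← Real.rpow_natCast]
  gcongr
  · linarith
  · exact_mod_cast hs

theorem exists_norm_completedRiemannZeta₀_le {δ : ℝ} (hδ : 0 < δ) :
    ∃ C : ℝ, 0 < C ∧ ∀ s : ℂ, 1 / 2 ≤ s.re →
      ‖completedRiemannZeta₀ s‖ ≤ C * Real.exp (δ * ‖s‖ ^ 2) := by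
  obtain ⟨C, hC, hfact⟩ := exists_factorial_le_mul_exp_sq hδ
  set Z := ∑' n : ℕ, 1 / ((n : ℝ) + 1) ^ 2 with hZ
  have hZ0 : 0 ≤ Z := tsum_nonneg fun n ↦ by positivity
  set A₀ := |(completedRiemannZeta₀ ((1 / 2 : ℝ) : ℂ)).re + (completedRiemannZeta₀ (4 : ℝ)).re|
  have hA₀ : 0 ≤ A₀ := abs_nonneg _
  refine ⟨A₀ + 2 * (C * Z + 2), by positivity, fun s hs ↦ ?_⟩
  have hexp : 1 ≤ Real.exp (δ * ‖s‖ ^ 2) := Real.one_le_exp (by positivity)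
  rcases le_total s.re 4 with h4 | h4
  · calc ‖completedRiemannZeta₀ s‖ ≤ A₀ := (norm_completedRiemannZeta₀_le hs h4).trans (le_abs_self _)
      _ ≤ A₀ + 2 * (C * Z + 2) := le_add_of_nonneg_right (by positivity)
      _ ≤ _ := le_mul_of_one_le_right (by positivity) hexp
  · set σ := s.re with hσ
    have hσs : σ ≤ ‖s‖ := Complex.re_le_norm s
    have hσ0 : (σ : ℂ) ≠ 0 := by exact_mod_cast (by linarith : σ ≠ 0)
    have hGre : 0 < (σ : ℂ).re := by simp; linarith
    have hΛ : completedRiemannZeta σ = (σ : ℂ).Gammaℝ * riemannZeta σ := by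
      rw [riemannZeta_def_of_ne_zero hσ0, mul_div_cancel₀ _ (Complex.Gammaℝ_ne_zero_of_re_pos hGre)]
    have hΓ : ‖(σ : ℂ).Gammaℝ‖ ≤ C * Real.exp (δ * ‖s‖ ^ 2) := by
      rw [Complex.Gammaℝ_def, norm_mul, Complex.norm_cpow_eq_rpow_re_of_pos Real.pi_pos,
        show (σ : ℂ) / 2 = ((σ / 2 : ℝ) : ℂ) by push_cast; rfl, Complex.Gamma_ofReal,
        Complex.norm_of_nonneg (Real.Gamma_pos_of_pos (by linarith)).le]
      set n := ⌈σ / 2⌉₊ with hn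
      have hn1 : σ / 2 ≤ n := Nat.le_ceil _
      have hn2 : (n : ℝ) < σ / 2 + 1 := Nat.ceil_lt_add_one (by linarith)
      have hpi : Real.pi ^ (-(σ : ℂ) / 2).re ≤ 1 := by
        refine Real.rpow_le_one_of_one_le_of_nonpos (by linarith [Real.pi_gt_three]) ?_
        simp
        linarith
      calc _ ≤ 1 * Real.Gamma (σ / 2) :=
            mul_le_mul_of_nonneg_right hpi (Real.Gamma_pos_of_pos (by linarith)).le
        _ ≤ Real.Gamma (n + 1) := by
            rw [one_mul]
            exact Real.Gamma_strictMonoOn_Ici.monotoneOn (by simp; linarith) (by simp; linarith)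
              (by linarith)
        _ ≤ C * Real.exp (δ * n ^ 2) := by rw [Real.Gamma_nat_eq_factorial]; exact hfact n
        _ ≤ C * Real.exp (δ * ‖s‖ ^ 2) := by
            gcongr
            linarith
    have hb := norm_completedRiemannZeta₀_le (a := σ) (b := σ) (s := s) le_rfl le_rfl
    have h1 : (completedRiemannZeta₀ σ).re ≤ C * Z * Real.exp (δ * ‖s‖ ^ 2) + 2 := by
      refine (Complex.re_le_norm _).trans ?_
      rw [show completedRiemannZeta₀ σ = completedRiemannZeta σ + 1 / σ + 1 / (1 - σ) by
        rw [completedRiemannZeta_eq]; ring]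
      refine norm_add₃_le.trans ?_
      have e1 : ‖(1 : ℂ) / σ‖ ≤ 1 := by
        rw [norm_div, norm_one, Complex.norm_of_nonneg (by linarith), div_le_one (by linarith)]
        linarith
      have e2 : ‖(1 : ℂ) / (1 - σ)‖ ≤ 1 := by
        rw [norm_div, norm_one, norm_sub_rev,
          show (σ : ℂ) - 1 = ((σ - 1 : ℝ) : ℂ) by push_cast; rfl,
          Complex.norm_of_nonneg (by linarith), div_le_one (by linarith)]
        linarith
      have e3 : ‖completedRiemannZeta σ‖ ≤ C * Real.exp (δ * ‖s‖ ^ 2) * Z := by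
        rw [hΛ, norm_mul]
        exact mul_le_mul hΓ (norm_riemannZeta_le_of_two_le_re (by simp; linarith))
          (norm_nonneg _) (by positivity)
      linarith
    nlinarith [mul_nonneg hA₀ (Real.exp_pos (δ * ‖s‖ ^ 2)).le]

theorem exists_norm_xiEntire_le {δ : ℝ} (hδ : 0 < δ) :
    ∃ C : ℝ, 0 < C ∧ ∀ s : ℂ, 1 / 2 ≤ s.re → ‖xiEntire s‖ ≤ C * Real.exp (δ * ‖s‖ ^ 2) := by
  have hη0 : 0 < δ / 2 := by positivity
  obtain ⟨C, hC, h⟩ := exists_norm_completedRiemannZeta₀_le hη0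
  refine ⟨1 + (4 / δ + 1) * C, by positivity, fun s hs ↦ ?_⟩
  set x := Real.exp (δ / 2 * ‖s‖ ^ 2) with hx
  have hx1 : 1 ≤ x := Real.one_le_exp (by positivity)
  have hxx : Real.exp (δ * ‖s‖ ^ 2) = x * x := by rw [hx, ← Real.exp_add]; ring_nf
  have hpoly : ‖s * (s - 1)‖ ≤ (4 / δ + 1) * x := by
    have h1 : ‖s * (s - 1)‖ ≤ ‖s‖ * (‖s‖ + 1) := by
      rw [norm_mul]
      gcongr
      simpa using norm_sub_le s 1
    have h2 : 2 / δ * (δ / 2 * ‖s‖ ^ 2 + 1) ≤ 2 / δ * x := by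
      gcongr
      exact Real.add_one_le_exp _
    have h3 : 2 / δ * (δ / 2 * ‖s‖ ^ 2 + 1) = ‖s‖ ^ 2 + 2 / δ := by field_simp
    have h4 : 0 < 2 / δ := by positivity
    have h5 : 4 / δ = 2 * (2 / δ) := by ring
    rw [h5]
    nlinarith [sq_nonneg (‖s‖ - 1)]
  calc ‖xiEntire s‖ ≤ 1 + ‖s * (s - 1)‖ * ‖completedRiemannZeta₀ s‖ := by
        rw [xiEntire]
        refine (norm_add_le _ _).trans ?_
        rw [norm_one, norm_mul (s * (s - 1))]
    _ ≤ 1 * (x * x) + (4 / δ + 1) * x * (C * x) := by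
        gcongr
        · nlinarith
        · exact h s hs
    _ = _ := by rw [hxx]; ring

/-- The entire function `G` with `G (u ^ 2) = xiEntire (1 / 2 + u)`. -/
noncomputable def xiSq (w : ℂ) : ℂ := xiEntire (1 / 2 + w ^ (2⁻¹ : ℂ))

theorem xiSq_sq (u : ℂ) : xiSq (u ^ 2) = xiEntire (1 / 2 + u) := by
  have h : ((u ^ 2) ^ (2⁻¹ : ℂ)) ^ 2 = u ^ 2 := Complex.cpow_ofNat_inv_pow (u ^ 2) 2
  rcases sq_eq_sq_iff_eq_or_eq_neg.1 h with h | h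
  · rw [xiSq, h]
  · rw [xiSq, h, ← xiEntire_one_sub]
    congr 1
    ring

theorem exists_sq_eq (w : ℂ) : ∃ u : ℂ, u ^ 2 = w ∧ 0 ≤ u.re := by
  have h : (w ^ (2⁻¹ : ℂ)) ^ 2 = w := Complex.cpow_ofNat_inv_pow w 2
  rcases le_total 0 (w ^ (2⁻¹ : ℂ)).re with h0 | h0
  · exact ⟨_, h, h0⟩
  · exact ⟨-w ^ (2⁻¹ : ℂ), by rw [neg_sq, h], by simpa using h0⟩

theorem differentiableAt_xiSq {w : ℂ} (hw : w ≠ 0) : DifferentiableAt ℂ xiSq w := by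
  obtain ⟨u, hu, -⟩ := exists_sq_eq w
  have h : xiSq = fun z ↦ xiEntire (1 / 2 + u * (z / w) ^ (2⁻¹ : ℂ)) := by
    ext z
    have h : ((z / w) ^ (2⁻¹ : ℂ)) ^ 2 = z / w := Complex.cpow_ofNat_inv_pow _ 2
    rw [← xiSq_sq, mul_pow, h, hu, mul_div_cancel₀ _ hw]
  rw [h]
  refine (differentiable_xiEntire _).comp w ?_
  refine (((differentiableAt_id.div_const w).cpow_const ?_).const_mul u).const_add _
  simp [div_self hw]

theorem differentiable_xiSq : Differentiable ℂ xiSq := fun w ↦ by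
  rcases eq_or_ne w 0 with rfl | hw
  · refine (Complex.analyticAt_of_differentiable_on_punctured_nhds_of_continuousAt
      (eventually_nhdsWithin_of_forall fun z hz ↦ differentiableAt_xiSq hz) ?_).differentiableAt
    refine differentiable_xiEntire.continuous.continuousAt.comp (continuousAt_const.add ?_)
    exact Complex.continuousAt_cpow_const_of_re_pos (by simp) (by norm_num)
  · exact differentiableAt_xiSq hw

theorem xiSq_zero_ne_zero : xiSq 0 ≠ 0 := by
  have := xiSq_sq 0
  rw [zero_pow two_ne_zero, add_zero] at this
  exact this ▸ xiEntire_one_half_ne_zero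

theorem analyticOrderAt_xiSq_ne_top (a : ℂ) : analyticOrderAt xiSq a ≠ ⊤ := fun h ↦
  xiSq_zero_ne_zero (congrFun ((AnalyticOnNhd.analyticOrderAt_eq_top_iff_eq_zero a
    fun z ↦ differentiable_xiSq.analyticAt z).1 h) 0)

theorem exists_norm_xiSq_le {ε : ℝ} (hε : 0 < ε) :
    ∃ C, 0 < C ∧ ∀ w, ‖xiSq w‖ ≤ C * Real.exp (ε * ‖w‖) := by
  obtain ⟨C, hC, h⟩ := exists_norm_xiEntire_le (half_pos hε)
  refine ⟨C * Real.exp (ε / 4), by positivity, fun w ↦ ?_⟩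
  obtain ⟨u, rfl, hu⟩ := exists_sq_eq w
  rw [xiSq_sq, mul_assoc, ← Real.exp_add]
  refine (h _ (by simpa using hu)).trans ?_
  gcongr
  have h1 : ‖1 / 2 + u‖ ≤ 1 / 2 + ‖u‖ := (norm_add_le _ _).trans (by simp)
  have h2 : ‖1 / 2 + u‖ ^ 2 ≤ (1 / 2 + ‖u‖) ^ 2 := by gcongr
  rw [norm_pow]
  nlinarith [mul_le_mul_of_nonneg_left h2 hε.le, mul_nonneg hε.le (sq_nonneg (‖u‖ - 1 / 2))]

theorem finite_xiSq_zeros (R : ℝ) : {a | xiSq a = 0 ∧ ‖a‖ ≤ R}.Finite := by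
  have h := AnalyticOnNhd.preimage_zero_mem_codiscrete
    (fun z _ ↦ differentiable_xiSq.analyticAt z) xiSq_zero_ne_zero
  have h' := mem_codiscrete'.1 h
  have hc : IsClosed (xiSq ⁻¹' {0}) := by simpa using h'.1
  have hd : IsDiscrete (xiSq ⁻¹' {0}) := by simpa using h'.2
  refine (((isCompact_closedBall (0 : ℂ) R).inter_left hc).finite
    (hd.mono Set.inter_subset_left)).subset fun a ha ↦ ?_
  simpa using ha

theorem xiSq_eq_zero_of_xi2_eq_zero {ρ : ℂ} (h : xi2 ρ = 0) (him : 0 < ρ.im) :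
    xiSq ((ρ - 1 / 2) ^ 2) = 0 := by
  rw [xiSq_sq, add_sub_cancel, ← xi2_eq_xiEntire (Or.inr him.ne'), h]

/-- Under the Riemann Hypothesis, `ρ ↦ (ρ - 1 / 2) ^ 2` identifies the zeros of `2ξ` in the upper
half-plane with the zeros of `xiSq`. -/
noncomputable def zerosEquiv (hRH : RiemannHypothesis) :
    {ρ : ℂ // xi2 ρ = 0 ∧ 0 < ρ.im} ≃ {a : ℂ // xiSq a = 0} :=
  Equiv.ofBijective (fun ρ ↦ ⟨(ρ - 1 / 2) ^ 2, xiSq_eq_zero_of_xi2_eq_zero ρ.2.1 ρ.2.2⟩) <| by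
    refine ⟨fun ρ σ h ↦ Subtype.ext ?_, fun ⟨a, ha⟩ ↦ ?_⟩
    · rcases sq_eq_sq_iff_eq_or_eq_neg.1 (congrArg Subtype.val h) with h | h
      · exact sub_left_injective h
      · have := congrArg Complex.im h
        have h1 := ρ.2.2
        have h2 := σ.2.2
        simp at this
        linarith
    · obtain ⟨u, rfl, -⟩ := exists_sq_eq a
      wlog hu : 0 ≤ u.im generalizing u
      · obtain ⟨ρ, hρ⟩ := this (-u) (by rwa [neg_sq]) (by simpa using (not_le.1 hu).le)
        exact ⟨ρ, by rw [hρ]; exact Subtype.ext (neg_sq u)⟩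
      rw [xiSq_sq] at ha
      have hre := re_eq_one_half_of_xiEntire_eq_zero hRH ha
      have hu0 : u.im ≠ 0 := fun h0 ↦ by
        have : u = 0 := Complex.ext (by simpa using hre) h0
        exact xiEntire_one_half_ne_zero (by simpa [this] using ha)
      have him : 0 < (1 / 2 + u).im := by simpa using lt_of_le_of_ne hu hu0.symm
      exact ⟨⟨1 / 2 + u, by rw [xi2_eq_xiEntire (Or.inr him.ne'), ha], him⟩,
        Subtype.ext (by simp)⟩

theorem re_of_xi2_eq_zero (hRH : RiemannHypothesis) {ρ : ℂ} (h : xi2 ρ = 0) (him : 0 < ρ.im) :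
    ρ.re = 1 / 2 :=
  re_eq_one_half_of_xiEntire_eq_zero hRH (by rw [← xi2_eq_xiEntire (Or.inr him.ne'), h])

theorem sub_one_half_sq (hRH : RiemannHypothesis) {ρ : ℂ} (h : xi2 ρ = 0) (him : 0 < ρ.im) :
    (ρ - 1 / 2) ^ 2 = -(ρ.im : ℂ) ^ 2 := by
  have : ρ - 1 / 2 = ρ.im * Complex.I :=
    Complex.ext (by simp [re_of_xi2_eq_zero hRH h him]) (by simp)
  rw [this, mul_pow, Complex.I_sq]
  ring

theorem xiOrder_eq {ρ : ℂ} (him : 0 < ρ.im) :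
    xiOrder ρ = analyticOrderNatAt xiSq ((ρ - 1 / 2) ^ 2) := by
  have hev : xi2 =ᶠ[nhds ρ] xiSq ∘ fun z ↦ (z - 1 / 2) ^ 2 := by
    filter_upwards [(isOpen_lt continuous_const Complex.continuous_im).mem_nhds him] with z hz
    rw [Function.comp_apply, xiSq_sq, add_sub_cancel, xi2_eq_xiEntire (Or.inr (ne_of_gt hz))]
  have han : AnalyticAt ℂ (xiSq ∘ fun z ↦ (z - 1 / 2) ^ 2) ρ :=
    (differentiable_xiSq.comp (by fun_prop)).analyticAt ρ
  have hd : deriv (fun z : ℂ ↦ (z - 1 / 2) ^ 2) ρ ≠ 0 := by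
    have : HasDerivAt (fun z : ℂ ↦ (z - 1 / 2) ^ 2) (2 * (ρ - 1 / 2)) ρ := by
      refine (((hasDerivAt_id' ρ).sub_const (1 / 2)).pow 2).congr_deriv ?_
      norm_num
    rw [this.deriv]
    refine mul_ne_zero two_ne_zero fun h ↦ him.ne' ?_
    simpa using congrArg Complex.im h
  have hord : analyticOrderAt (xiSq ∘ fun z ↦ (z - 1 / 2) ^ 2) ρ =
      analyticOrderAt xiSq ((ρ - 1 / 2) ^ 2) :=
    analyticOrderAt_comp_of_deriv_ne_zero (by fun_prop) hd
  have hset (k : ℕ) : (∃ g : ℂ → ℂ, AnalyticAt ℂ g ρ ∧ g ρ ≠ 0 ∧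
      ∀ᶠ z in nhds ρ, xi2 z = (z - ρ) ^ k * g z) ↔
      k = analyticOrderNatAt xiSq ((ρ - 1 / 2) ^ 2) := by
    have := (han.congr hev.symm).analyticOrderAt_eq_natCast (n := k)
    simp only [smul_eq_mul] at this
    rw [← this, analyticOrderAt_congr hev, hord,
      ← Nat.cast_analyticOrderNatAt (analyticOrderAt_xiSq_ne_top _), Nat.cast_inj, eq_comm]
  simp only [xiOrder, hset]
  exact csInf_singleton _

/-- The Möbius image of the critical line: `(1 / (1 - z) - 1 / 2) ^ 2`. -/
noncomputable def cayleySq (z : ℂ) : ℂ := ((1 + z) / (2 * (1 - z))) ^ 2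

/-- The angle `θ ∈ (0, π)` with `(1 / 2) cot (θ / 2) = T`. -/
noncomputable def zeroAngle (T : ℝ) : ℝ := 2 * Real.arctan (1 / (2 * T))

theorem exp_zeroAngle {T : ℝ} (hT : 0 < T) :
    Complex.exp (zeroAngle T * Complex.I) * (2 * T - Complex.I) = 2 * T + Complex.I := by
  have hx : (0 : ℝ) < 1 + (1 / (2 * T)) ^ 2 := by positivity
  have h2 : Complex.exp (zeroAngle T * Complex.I) =
      (Real.cos (Real.arctan (1 / (2 * T))) +
        Real.sin (Real.arctan (1 / (2 * T))) * Complex.I) ^ 2 := by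
    rw [zeroAngle, Complex.ofReal_cos, Complex.ofReal_sin, ← Complex.exp_mul_I,
      ← Complex.exp_nat_mul]
    congr 1
    push_cast
    ring
  have hs : ((√(1 + (1 / (2 * T)) ^ 2) : ℝ) : ℂ) ^ 2 = 1 + (1 / (2 * T)) ^ 2 := by
    rw [← Complex.ofReal_pow, Real.sq_sqrt hx.le]
    push_cast
    ring
  have hs0 : ((√(1 + (1 / (2 * T)) ^ 2) : ℝ) : ℂ) ≠ 0 := by
    exact_mod_cast (Real.sqrt_pos.2 hx).ne'
  have hT0 : (T : ℂ) ≠ 0 := by exact_mod_cast hT.ne'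
  rw [h2, Real.cos_arctan, Real.sin_arctan]
  push_cast
  set s : ℂ := ((√(1 + (1 / (2 * T)) ^ 2) : ℝ) : ℂ)
  have h3 : (1 / s + 1 / (2 * T) / s * Complex.I) ^ 2 =
      (1 + 1 / (2 * T) * Complex.I) ^ 2 / s ^ 2 := by
    field_simp
  have hs2 : (1 : ℂ) + (1 / (2 * T)) ^ 2 ≠ 0 := hs ▸ pow_ne_zero 2 hs0
  rw [h3, hs, div_mul_eq_mul_div, div_eq_iff hs2]
  field_simp
  linear_combination (-(2 * T + Complex.I)) * Complex.I_sq

theorem two_sub_exp_pow (x : ℝ) (n : ℕ) :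
    2 - Complex.exp (x * Complex.I) ^ n - (Complex.exp (x * Complex.I))⁻¹ ^ n =
      ((2 - 2 * Real.cos (n * x) : ℝ) : ℂ) := by
  rw [← Complex.exp_neg, ← Complex.exp_nat_mul, ← Complex.exp_nat_mul]
  push_cast
  rw [Complex.cos]
  ring_nf

theorem one_sub_cayleySq_div {T : ℝ} (hT : 0 < T) {z : ℂ} (hz : z ≠ 1) :
    1 - cayleySq z / -(T : ℂ) ^ 2 = (1 + 1 / (4 * T ^ 2)) *
      ((1 - Complex.exp (zeroAngle T * Complex.I) * z) *
        (1 - (Complex.exp (zeroAngle T * Complex.I))⁻¹ * z) / (1 - z) ^ 2) := by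
  have h := exp_zeroAngle hT
  set c := Complex.exp (zeroAngle T * Complex.I)
  have hc : c ≠ 0 := Complex.exp_ne_zero _
  have hT0 : (T : ℂ) ≠ 0 := by exact_mod_cast hT.ne'
  have hz' : 1 - z ≠ 0 := sub_ne_zero.2 hz.symm
  have h1 : 2 * (T : ℂ) + Complex.I ≠ 0 := fun h ↦ by simpa using congrArg Complex.im h
  have h2 : 2 * (T : ℂ) - Complex.I ≠ 0 := fun h ↦ by simpa using congrArg Complex.im h
  have hc' : c = (2 * T + Complex.I) / (2 * T - Complex.I) := by rw [eq_div_iff h2, h]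
  rw [hc', inv_div, cayleySq]
  field_simp
  linear_combination 64 * T ^ 2 * z * Complex.I_sq

theorem norm_cayleySq_le {z : ℂ} (hz : ‖z‖ ≤ 1 / 2) : ‖cayleySq z‖ ≤ 9 / 4 := by
  have h1 : ‖1 + z‖ ≤ 3 / 2 := (norm_add_le _ _).trans (by rw [norm_one]; linarith)
  have h2 : 1 / 2 ≤ ‖1 - z‖ := by
    have := norm_sub_norm_le 1 z
    rw [norm_one] at this
    linarith
  have h3 : ‖(1 + z) / (2 * (1 - z))‖ ≤ 3 / 2 := by
    rw [norm_div, norm_mul, Complex.norm_ofNat, div_le_iff₀ (by linarith)]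
    linarith
  rw [cayleySq, norm_pow]
  calc _ ≤ (3 / 2 : ℝ) ^ 2 := by gcongr
    _ = _ := by norm_num

theorem xi2_one_div_one_sub {z : ℂ} (hz : ‖z‖ < 1) : xi2 (1 / (1 - z)) = xiSq (cayleySq z) := by
  have hre : 0 < (1 - z).re := by
    have := (Complex.re_le_norm z).trans_lt hz
    simpa using this
  have h0 : 1 - z ≠ 0 := fun h ↦ by simp [h] at hre
  rw [cayleySq, xiSq_sq, xi2_eq_xiEntire]
  · congr 1
    field_simp
    ring
  · left
    rw [one_div, Complex.inv_re]
    exact div_pos hre (Complex.normSq_pos.2 h0)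

theorem exists_eq_neg_sq_of_xiSq_eq_zero (hRH : RiemannHypothesis) {a : ℂ} (ha : xiSq a = 0) :
    0 < √(-a.re) ∧ a = -((√(-a.re) : ℝ) : ℂ) ^ 2 := by
  obtain ⟨ρ, hρ⟩ := (zerosEquiv hRH).surjective ⟨a, ha⟩
  have h : (ρ - 1 / 2 : ℂ) ^ 2 = a := congrArg Subtype.val hρ
  rw [sub_one_half_sq hRH ρ.2.1 ρ.2.2] at h
  have h' : -a.re = (ρ : ℂ).im ^ 2 := by
    rw [← h, ← Complex.ofReal_pow, Complex.neg_re, Complex.ofReal_re, neg_neg]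
  rw [h', Real.sqrt_sq ρ.2.2.le]
  exact ⟨ρ.2.2, h.symm⟩

theorem abs_lambdaK_sub_sum_le (hRH : RiemannHypothesis) {n : ℕ} (hn : 1 ≤ n) {R M : ℝ}
    (hR : 9 / 2 ≤ R) (hM : 0 < M)
    (hb : ∀ w, ‖w‖ = 4 * R → ‖xiSq w‖ ≤ ‖xiSq 0‖ * Real.exp M) (S : Finset ℂ)
    (hS : ∀ a, a ∈ S ↔ xiSq a = 0 ∧ ‖a‖ ≤ R) :
    |lambdaK n - ∑ a ∈ S, analyticOrderNatAt xiSq a *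
      ((2 - 2 * Real.cos (n * zeroAngle √(-a.re))) / n)| ≤ 2 ^ n * (9 * M / R) := by
  have hR0 : 0 < R := by linarith
  obtain ⟨L, hLd, hL⟩ := exists_eq_prod_mul_exp differentiable_xiSq xiSq_zero_ne_zero
    analyticOrderAt_xiSq_ne_top hR0 hM hb S hS
  have hmem {z : ℂ} (hz : ‖z‖ ≤ 1 / 2) : cayleySq z ∈ Metric.ball 0 R := by
    rw [mem_ball_zero_iff]
    linarith [norm_cayleySq_le hz]
  have hne {z : ℂ} (hz : ‖z‖ ≤ 1 / 2) : z ≠ 1 := by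
    rintro rfl
    norm_num at hz
  have hEd : DifferentiableOn ℂ (L ∘ cayleySq) (Metric.closedBall 0 (1 / 2)) := by
    refine hLd.comp (fun z hz ↦ ?_) fun z hz ↦ hmem (by simpa using hz)
    have : 2 * (1 - z) ≠ 0 :=
      mul_ne_zero two_ne_zero (sub_ne_zero.2 (hne (by simpa using hz)).symm)
    unfold cayleySq
    fun_prop (disch := assumption)
  have hEn (z : ℂ) (hz : ‖z‖ ≤ 1 / 2) : ‖(L ∘ cayleySq) z‖ ≤ 9 * M / R := by
    have h1 := norm_cayleySq_le hz
    refine (hL _ (hmem hz)).1.trans ?_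
    rw [div_le_div_iff₀ (by linarith) hR0]
    nlinarith [mul_le_mul_of_nonneg_left h1 hM.le, mul_pos hM hR0, norm_nonneg (cayleySq z)]
  have hEa : AnalyticAt ℂ (L ∘ cayleySq) 0 :=
    hEd.analyticAt (Metric.closedBall_mem_nhds _ (by norm_num))
  have hder : ‖iteratedDeriv n (L ∘ cayleySq) 0‖ ≤ n ! * (9 * M / R) / (1 / 2) ^ n :=
    Complex.norm_iteratedDeriv_le_of_forall_mem_sphere_norm_le n (by norm_num)
      (DifferentiableOn.diffContOnCl (by rwa [closure_ball _ (by norm_num)]))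
      fun z hz ↦ hEn z (le_of_eq (by simpa using hz))
  have hF : ∀ᶠ z in nhds (0 : ℂ), xi2 (1 / (1 - z)) =
      (xiSq 0 * ∏ a ∈ S, (1 + 1 / (4 * ((√(-a.re) : ℝ) : ℂ) ^ 2)) ^ analyticOrderNatAt xiSq a) *
      (∏ a ∈ S, ((1 - Complex.exp (zeroAngle √(-a.re) * Complex.I) * z) *
        (1 - (Complex.exp (zeroAngle √(-a.re) * Complex.I))⁻¹ * z) / (1 - z) ^ 2) ^
          analyticOrderNatAt xiSq a) * Complex.exp ((L ∘ cayleySq) z) := by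
    filter_upwards [Metric.closedBall_mem_nhds (0 : ℂ) (by norm_num : (0 : ℝ) < 1 / 2)] with z hz
    have hz : ‖z‖ ≤ 1 / 2 := by simpa using hz
    rw [xi2_one_div_one_sub (hz.trans_lt (by norm_num)), (hL _ (hmem hz)).2, Function.comp_apply]
    congr 1
    rw [mul_assoc, ← Finset.prod_mul_distrib]
    congr 1
    refine Finset.prod_congr rfl fun a ha ↦ ?_
    obtain ⟨hT, haT⟩ := exists_eq_neg_sq_of_xiSq_eq_zero hRH ((hS a).1 ha).1
    rw [← mul_pow, ← one_sub_cayleySq_div hT (hne hz), ← haT]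
  have key := iteratedDeriv_log_prod_mul_exp (F := fun z ↦ xi2 (1 / (1 - z))) S _ _ _ hEa
    (by simp [xi2]) hF hn
  have hlam : lambdaK n = ∑ a ∈ S, analyticOrderNatAt xiSq a *
      ((2 - 2 * Real.cos (n * zeroAngle √(-a.re))) / n) +
        (iteratedDeriv n (L ∘ cayleySq) 0 / (n ! : ℂ)).re := by
    rw [lambdaK]
    change (iteratedDeriv n (fun z ↦ Complex.log (xi2 (1 / (1 - z)))) 0 / (n ! : ℂ)).re = _
    rw [key, Complex.add_re, Complex.re_sum]
    congr 1
    refine Finset.sum_congr rfl fun a _ ↦ ?_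
    rw [two_sub_exp_pow, ← Complex.ofReal_natCast, ← Complex.ofReal_natCast, ← Complex.ofReal_div,
      ← Complex.ofReal_mul, Complex.ofReal_re]
  rw [hlam, add_sub_cancel_left]
  refine (Complex.abs_re_le_norm _).trans ?_
  rw [norm_div, Complex.norm_natCast, div_le_iff₀ (by positivity)]
  refine hder.trans_eq ?_
  rw [one_div, inv_pow, div_inv_eq_mul]
  ring

theorem exists_forall_abs_lambdaK_sub_sum_le (hRH : RiemannHypothesis) {n : ℕ} (hn : 1 ≤ n)
    {δ : ℝ} (hδ : 0 < δ) :
    ∃ R₀, ∀ R, R₀ ≤ R → |lambdaK n - ∑ a ∈ (finite_xiSq_zeros R).toFinset,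
      analyticOrderNatAt xiSq a * ((2 - 2 * Real.cos (n * zeroAngle √(-a.re))) / n)| ≤ δ := by
  obtain ⟨ε, hε, hεδ⟩ : ∃ ε : ℝ, 0 < ε ∧ 2 ^ n * (36 * ε) ≤ δ / 2 :=
    ⟨δ / (2 * 36 * 2 ^ n), by positivity, by field_simp; norm_num⟩
  obtain ⟨C, hC, hG⟩ := exists_norm_xiSq_le hε
  have h0 : 0 < ‖xiSq 0‖ := norm_pos_iff.2 xiSq_zero_ne_zero
  refine ⟨max (9 / 2) (2 ^ n * (18 * (C / ‖xiSq 0‖)) / δ), fun R hR ↦ ?_⟩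
  have hR1 := (le_max_left _ _).trans hR
  have hR2 := (le_max_right _ _).trans hR
  have hR0 : 0 < R := by linarith
  refine (abs_lambdaK_sub_sum_le hRH hn hR1 (M := C / ‖xiSq 0‖ + ε * (4 * R)) (by positivity)
    (fun w hw ↦ ?_) _ (by simp)).trans ?_
  · refine (hG w).trans ?_
    rw [hw, Real.exp_add, ← mul_assoc ‖xiSq 0‖]
    refine mul_le_mul_of_nonneg_right ?_ (Real.exp_pos _).le
    have := (Real.add_one_le_exp (C / ‖xiSq 0‖))
    calc C = ‖xiSq 0‖ * (C / ‖xiSq 0‖) := by field_simp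
      _ ≤ _ := by gcongr; linarith
  · rw [div_le_iff₀ hδ] at hR2
    have : 2 ^ n * (9 * (C / ‖xiSq 0‖ + ε * (4 * R)) / R) =
        2 ^ n * (18 * (C / ‖xiSq 0‖)) / (2 * R) + 2 ^ n * (36 * ε) := by
      field_simp
      ring
    rw [this]
    have : 2 ^ n * (18 * (C / ‖xiSq 0‖)) / (2 * R) ≤ δ / 2 := by
      rw [div_le_iff₀ (by positivity)]
      linarith
    linarith

theorem hasSum_subtype_of_forall_abs_sub_sum_le {E : Type*} [SeminormedAddCommGroup E]
    {p : E → Prop} {f : E → ℝ} (hf : ∀ a, 0 ≤ f a) {l : ℝ} {S : ℝ → Finset E}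
    (hS : ∀ R a, a ∈ S R ↔ p a ∧ ‖a‖ ≤ R)
    (h : ∀ δ, 0 < δ → ∃ R₀, ∀ R, R₀ ≤ R → |l - ∑ a ∈ S R, f a| ≤ δ) :
    HasSum (fun a : {a // p a} ↦ f a) l := by
  refine hasSum_of_isLUB_of_nonneg _ (fun a ↦ hf a) ⟨?_, fun b hb ↦ ?_⟩
  · rintro _ ⟨s, rfl⟩
    refine le_of_forall_pos_le_add fun δ hδ ↦ ?_
    obtain ⟨R₀, h⟩ := h δ hδ
    have h1 := h (max R₀ (∑ a ∈ s, ‖(a : E)‖)) (le_max_left _ _)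
    have h2 : ∑ a ∈ s.map (Function.Embedding.subtype _), f a ≤
        ∑ a ∈ S (max R₀ (∑ a ∈ s, ‖(a : E)‖)), f a := by
      refine Finset.sum_le_sum_of_subset_of_nonneg (fun a ha ↦ ?_) fun a _ _ ↦ hf a
      obtain ⟨a, has, rfl⟩ := Finset.mem_map.1 ha
      exact (hS _ _).2 ⟨a.2, le_max_of_le_right
        (Finset.single_le_sum (f := fun a : {a // p a} ↦ ‖(a : E)‖)
          (fun _ _ ↦ norm_nonneg _) has)⟩
    rw [Finset.sum_map] at h2
    simp only [Function.Embedding.subtype_apply] at h2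
    linarith [(abs_le.1 h1).1]
  · refine le_of_forall_pos_le_add fun δ hδ ↦ ?_
    obtain ⟨R₀, h⟩ := h δ hδ
    have h1 := h R₀ le_rfl
    have h2 : ∑ a ∈ S R₀, f a ≤ b := by
      classical
      rw [← Finset.sum_subtype_of_mem f fun a ha ↦ ((hS R₀ a).1 ha).1]
      exact hb ⟨_, rfl⟩
    linarith [(abs_le.1 h1).2]

theorem hasSum_xiSq_zeros (hRH : RiemannHypothesis) {n : ℕ} (hn : 1 ≤ n) :
    HasSum (fun a : {a : ℂ // xiSq a = 0} ↦ analyticOrderNatAt xiSq a *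
      ((2 - 2 * Real.cos (n * zeroAngle √(-(a : ℂ).re))) / n)) (lambdaK n) :=
  hasSum_subtype_of_forall_abs_sub_sum_le
    (f := fun a : ℂ ↦ analyticOrderNatAt xiSq a *
      ((2 - 2 * Real.cos (n * zeroAngle √(-a.re))) / n))
    (fun a ↦ mul_nonneg (Nat.cast_nonneg _)
      (div_nonneg (by linarith [Real.cos_le_one (n * zeroAngle √(-a.re))]) (Nat.cast_nonneg _)))
    (fun R a ↦ (finite_xiSq_zeros R).mem_toFinset)
    fun _ hδ ↦ exists_forall_abs_lambdaK_sub_sum_le hRH hn hδ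

theorem hasSum_lambdaK (hRH : RiemannHypothesis) {n : ℕ} (hn : 1 ≤ n) :
    HasSum (fun ρ : {ρ : ℂ // xi2 ρ = 0 ∧ 0 < ρ.im} ↦ (xiOrder ρ : ℝ) *
      ((2 - 2 * Real.cos (n * zeroAngle (ρ : ℂ).im)) / n)) (lambdaK n) := by
  convert (zerosEquiv hRH).hasSum_iff.2 (hasSum_xiSq_zeros hRH hn) using 2 with ρ
  have h : ((zerosEquiv hRH ρ : ℂ)) = (ρ - 1 / 2) ^ 2 := rfl
  have h' : √(-(((ρ : ℂ) - 1 / 2) ^ 2).re) = (ρ : ℂ).im := by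
    rw [sub_one_half_sq hRH ρ.2.1 ρ.2.2, ← Complex.ofReal_pow, Complex.neg_re, Complex.ofReal_re,
      neg_neg, Real.sqrt_sq ρ.2.2.le]
  rw [Function.comp_apply, h, h', xiOrder_eq ρ.2.2]

theorem zeroAngle_pos {T : ℝ} (hT : 0 < T) : 0 < zeroAngle T :=
  mul_pos two_pos (Real.arctan_pos.2 (by positivity))

theorem zeroAngle_lt_pi (T : ℝ) : zeroAngle T < Real.pi := by
  rw [zeroAngle]
  linarith [Real.arctan_lt_pi_div_two (1 / (2 * T))]

theorem le_half_cot_iff {T θ : ℝ} (hT : 0 < T) (h0 : 0 < θ) (hπ : θ ≤ Real.pi) :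
    T ≤ 1 / 2 * Real.cot (θ / 2) ↔ θ ≤ zeroAngle T := by
  have hs : 0 < Real.sin (θ / 2) := Real.sin_pos_of_pos_of_lt_pi (by linarith) (by linarith)
  rcases hπ.eq_or_lt with rfl | hπ
  · simp [Real.cot_eq_cos_div_sin, hT, (zeroAngle_lt_pi T).not_ge]
  · have hc : 0 < Real.cos (θ / 2) := Real.cos_pos_of_mem_Ioo ⟨by linarith, by linarith⟩
    have h1 : θ ≤ zeroAngle T ↔ Real.tan (θ / 2) ≤ 1 / (2 * T) := by
      rw [← Real.arctan_strictMono.le_iff_le (a := Real.tan (θ / 2)),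
        Real.arctan_tan (by linarith) (by linarith), zeroAngle, div_le_iff₀' two_pos]
    rw [h1, Real.cot_eq_cos_div_sin, Real.tan_eq_sin_div_cos, div_le_div_iff₀ hc (by positivity),
      ← mul_div_assoc, le_div_iff₀ hs]
    constructor <;> intro h <;> linarith

theorem Ncount_half_cot {θ : ℝ} (h0 : 0 < θ) (hπ : θ ≤ Real.pi) :
    Ncount (1 / 2 * Real.cot (θ / 2)) = ∑' ρ : {ρ : ℂ // xi2 ρ = 0 ∧ 0 < ρ.im},
      (Set.Iic (zeroAngle (ρ : ℂ).im)).indicator (fun _ ↦ (xiOrder ρ : ℝ)) θ := by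
  have h1 := tsum_subtype {ρ : ℂ | xi2 ρ = 0 ∧ 0 < ρ.im ∧ ρ.im ≤ 1 / 2 * Real.cot (θ / 2)}
    fun ρ ↦ (xiOrder ρ : ℝ)
  have h2 := tsum_subtype {ρ : ℂ | xi2 ρ = 0 ∧ 0 < ρ.im}
    fun ρ ↦ (Set.Iic (zeroAngle ρ.im)).indicator (fun _ ↦ (xiOrder ρ : ℝ)) θ
  refine h1.trans (Eq.trans (tsum_congr fun ρ ↦ ?_) h2.symm)
  by_cases h : xi2 ρ = 0 ∧ 0 < ρ.im
  · have := le_half_cot_iff h.2 h0 hπ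
    by_cases h' : ρ.im ≤ 1 / 2 * Real.cot (θ / 2)
    · rw [Set.indicator_of_mem (by exact ⟨h.1, h.2, h'⟩), Set.indicator_of_mem (by exact h),
        Set.indicator_of_mem (by exact this.1 h')]
    · rw [Set.indicator_of_notMem (fun hm ↦ h' hm.2.2), Set.indicator_of_mem (by exact h),
        Set.indicator_of_notMem (by exact fun hm ↦ h' (this.2 hm))]
  · rw [Set.indicator_of_notMem (fun hm ↦ h ⟨hm.1, hm.2.1⟩), Set.indicator_of_notMem (by exact h)]

theorem countable_zeros (hRH : RiemannHypothesis) :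
    Countable {ρ : ℂ // xi2 ρ = 0 ∧ 0 < ρ.im} := by
  have h : {a : ℂ | xiSq a = 0}.Countable :=
    (Set.countable_iUnion fun k : ℕ ↦ (finite_xiSq_zeros k).countable).mono fun a ha ↦
      Set.mem_iUnion.2 ((exists_nat_ge ‖a‖).imp fun k hk ↦ And.intro ha hk)
  have : Countable {a : ℂ // xiSq a = 0} := h.to_subtype
  exact (zerosEquiv hRH).injective.countable

theorem integral_sin_nat_mul {n : ℕ} (hn : 1 ≤ n) (a : ℝ) :
    ∫ θ in (0 : ℝ)..a, Real.sin (n * θ) = (1 - Real.cos (n * a)) / n := by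
  have hn0 : (n : ℝ) ≠ 0 := by exact_mod_cast (by omega : n ≠ 0)
  rw [intervalIntegral.integral_comp_mul_left _ hn0, integral_sin, mul_zero, Real.cos_zero,
    smul_eq_mul]
  field_simp

theorem integral_abs_sin_nat_mul_le (n : ℕ) {a : ℝ} (h0 : 0 ≤ a) (hπ : a ≤ Real.pi) :
    ∫ θ in (0 : ℝ)..a, |Real.sin (n * θ)| ≤ n * Real.pi ^ 2 / 8 * (2 - 2 * Real.cos a) := by
  have h1 : ∫ θ in (0 : ℝ)..a, |Real.sin (n * θ)| ≤ ∫ θ in (0 : ℝ)..a, n * θ := by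
    refine intervalIntegral.integral_mono_on h0 (Continuous.intervalIntegrable (by fun_prop) _ _)
      (Continuous.intervalIntegrable (by fun_prop) _ _) fun θ hθ ↦ ?_
    have : 0 ≤ n * θ := mul_nonneg (Nat.cast_nonneg _) hθ.1
    exact Real.abs_sin_le_abs.trans_eq (abs_of_nonneg this)
  have h2 := Real.cos_le_one_sub_mul_cos_sq (abs_le.2 ⟨by linarith, hπ⟩)
  have h3 : a ^ 2 ≤ Real.pi ^ 2 / 2 * (1 - Real.cos a) := by
    have := Real.pi_pos
    have h4 : 2 / Real.pi ^ 2 * a ^ 2 ≤ 1 - Real.cos a := by linarith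
    calc a ^ 2 = Real.pi ^ 2 / 2 * (2 / Real.pi ^ 2 * a ^ 2) := by field_simp
      _ ≤ _ := by gcongr
  refine h1.trans ?_
  rw [intervalIntegral.integral_const_mul, integral_id]
  nlinarith [mul_le_mul_of_nonneg_left h3 (Nat.cast_nonneg (α := ℝ) n)]

theorem hasSum_integral_zeros (hRH : RiemannHypothesis) {n : ℕ} (hn : 1 ≤ n) :
    HasSum (fun ρ : {ρ : ℂ // xi2 ρ = 0 ∧ 0 < ρ.im} ↦ (xiOrder ρ : ℝ) *
      ((1 - Real.cos (n * zeroAngle (ρ : ℂ).im)) / n))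
      (∫ θ in (0 : ℝ)..Real.pi, Real.sin (n * θ) * Ncount (1 / 2 * Real.cot (θ / 2))) := by
  have := countable_zeros hRH
  let F (ρ : {ρ : ℂ // xi2 ρ = 0 ∧ 0 < ρ.im}) (θ : ℝ) : ℝ := Real.sin (n * θ) *
    (Set.Iic (zeroAngle (ρ : ℂ).im)).indicator (fun _ ↦ (xiOrder ρ : ℝ)) θ
  have hF (ρ) : F ρ = (Set.Iic (zeroAngle (ρ : ℂ).im)).indicator
      fun θ ↦ Real.sin (n * θ) * xiOrder ρ := by
    ext θ
    rw [Set.indicator_mul_right]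
  have hinter (ρ : {ρ : ℂ // xi2 ρ = 0 ∧ 0 < ρ.im}) :
      Set.Ioc 0 Real.pi ∩ Set.Iic (zeroAngle (ρ : ℂ).im) = Set.Ioc 0 (zeroAngle (ρ : ℂ).im) := by
    rw [Set.Ioc_inter_Iic, inf_eq_right.2 (zeroAngle_lt_pi _).le]
  have h_int (ρ) : MeasureTheory.IntegrableOn (F ρ) (Set.Ioc 0 Real.pi) := by
    rw [hF]
    refine MeasureTheory.IntegrableOn.indicator ?_ measurableSet_Iic
    exact (Continuous.integrableOn_Icc (by fun_prop)).mono_set Set.Ioc_subset_Icc_self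
  have hval (ρ) : ∫ θ in Set.Ioc 0 Real.pi, F ρ θ =
      xiOrder ρ * ((1 - Real.cos (n * zeroAngle (ρ : ℂ).im)) / n) := by
    rw [hF, MeasureTheory.setIntegral_indicator measurableSet_Iic, hinter,
      ← intervalIntegral.integral_of_le (zeroAngle_pos ρ.2.2).le,
      intervalIntegral.integral_mul_const, integral_sin_nat_mul hn, mul_comm]
  have hnorm (ρ) : ∫ θ in Set.Ioc 0 Real.pi, ‖F ρ θ‖ ≤
      n * Real.pi ^ 2 / 8 * (xiOrder ρ *
        ((2 - 2 * Real.cos ((1 : ℕ) * zeroAngle (ρ : ℂ).im)) / (1 : ℕ))) := by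
    have h : (fun θ ↦ ‖F ρ θ‖) = (Set.Iic (zeroAngle (ρ : ℂ).im)).indicator
        fun θ ↦ |Real.sin (n * θ)| * xiOrder ρ := by
      ext θ
      rw [hF, norm_indicator_eq_indicator_norm]
      simp
    rw [h, MeasureTheory.setIntegral_indicator measurableSet_Iic, hinter,
      ← intervalIntegral.integral_of_le (zeroAngle_pos ρ.2.2).le,
      intervalIntegral.integral_mul_const, Nat.cast_one, one_mul, div_one]
    calc _ ≤ n * Real.pi ^ 2 / 8 * (2 - 2 * Real.cos (zeroAngle (ρ : ℂ).im)) * xiOrder ρ := by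
          gcongr
          exact integral_abs_sin_nat_mul_le n (zeroAngle_pos ρ.2.2).le (zeroAngle_lt_pi _).le
      _ = _ := by ring
  have hsum : Summable fun ρ ↦ ∫ θ in Set.Ioc 0 Real.pi, ‖F ρ θ‖ :=
    Summable.of_nonneg_of_le (fun ρ ↦ MeasureTheory.integral_nonneg fun _ ↦ norm_nonneg _) hnorm
      ((hasSum_lambdaK hRH le_rfl).summable.mul_left _)
  have key := MeasureTheory.hasSum_integral_of_summable_integral_norm h_int hsum
  simp only [hval] at key
  rwa [intervalIntegral.integral_of_le Real.pi_pos.le,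
    MeasureTheory.setIntegral_congr_fun (g := fun θ ↦ ∑' ρ, F ρ θ) measurableSet_Ioc fun θ hθ ↦ by
      simp only [F]
      rw [tsum_mul_left, Ncount_half_cot hθ.1 hθ.2]]

/-- Integral representation under RH:
`λ_n^K = 2 ∫₀^π sin(nθ) N((1/2) cot(θ/2)) dθ`. -/
theorem lambdaK_integral_of_RH (hRH : RiemannHypothesis) (n : ℕ) (hn : 1 ≤ n) :
    lambdaK n =
      2 * ∫ θ in (0 : ℝ)..Real.pi,
        Real.sin (n * θ) * Ncount (1 / 2 * Real.cot (θ / 2)) := by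
  rw [← (hasSum_lambdaK hRH hn).tsum_eq, ← (hasSum_integral_zeros hRH hn).tsum_eq, ← tsum_mul_left]
  exact tsum_congr fun ρ ↦ by ring
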